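/- arXiv:1801.04511 — 6 statements merged into one kernel-verified Lean document; each statement's English description precedes it below -/
import Mathlib

section
/- Fix Γ > 0, μ > 0 and δ ∈ [0, 4/5]. There is a constant C > 0 depending only on Γ, μ and δ such that for every bounded continuous function χ : ℝ³ → ℝ and every ε ∈ (0, 1], the surface integral over the unit sphere satisfies ‖ ε² ∫_{|x|=1} χ(εx) ∇φ_δ(εx) ⊗ x dH²(x) ‖ ≤ C ε^{1 − δ/2} sup_{ℝ³} |χ|; in particular this quantity tends to 0 as ε → 0⁺. -/
open MeasureTheory Real Filter

noncomputable section

abbrev E3 := EuclideanSpace ℝ (Fin 3)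

/-- The pointwise gradient of `φ_δ`:
`∇φ_δ(z) = −(Γ/2) (2 + δ μ² |z|^{δ−2}) (|z|² + μ² |z|^δ)^{−3/2} z`. -/
noncomputable def gradPhi (Γ μ δ : ℝ) (z : E3) : E3 :=
  (-(Γ / 2) * (2 + δ * μ ^ 2 * ‖z‖ ^ (δ - 2)) *
    (‖z‖ ^ 2 + μ ^ 2 * ‖z‖ ^ δ) ^ (-(3 : ℝ) / 2)) • z

/-- The `(i,j)` entry of the surface integral
`ε² ∫_{|x|=1} χ(εx) ∇φ_δ(εx) ⊗ x dH²(x)` over the unit sphere of `ℝ³`,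
with respect to the 2-dimensional Hausdorff measure. -/
noncomputable def sphereTerm (Γ μ δ : ℝ) (χ : E3 → ℝ) (ε : ℝ) (i j : Fin 3) : ℝ :=
  ε ^ 2 * ∫ x in Metric.sphere (0 : E3) 1,
    χ (ε • x) * (gradPhi Γ μ δ (ε • x) i * x j) ∂(μH[2])

/-- Spherical coordinates, parametrizing the unit sphere by the polar and azimuthal angles. -/
def sphericalCoords (p : Fin 2 → ℝ) : E3 :=
  !₂[sin (p 0) * cos (p 1), sin (p 0) * sin (p 1), cos (p 0)]

lemma contDiff_sphericalCoords : ContDiff ℝ 1 sphericalCoords := by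
  refine contDiff_euclidean.2 fun i => ?_
  fin_cases i <;> simp [sphericalCoords] <;> fun_prop

lemma sphere_subset_image_sphericalCoords :
    Metric.sphere (0 : E3) 1 ⊆
      sphericalCoords '' Set.Icc (fun _ => -π) (fun _ => π) := by
  intro x hx
  have hsum : x 0 ^ 2 + x 1 ^ 2 + x 2 ^ 2 = 1 := by
    have h := EuclideanSpace.norm_sq_eq x
    rw [mem_sphere_zero_iff_norm.1 hx] at h
    simp [Fin.sum_univ_three] at h
    exact h.symm
  set w : ℂ := ⟨x 0, x 1⟩ with hw
  have hsin : sin (arccos (x 2)) = ‖w‖ := by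
    rw [sin_arccos, Complex.norm_def, Complex.normSq_apply]
    congr 1
    simp only [hw]
    linarith
  refine ⟨![arccos (x 2), w.arg], ⟨fun i => ?_, fun i => ?_⟩, ?_⟩
  · fin_cases i
    · simpa using (neg_nonpos.2 pi_pos.le).trans (arccos_nonneg (x 2))
    · simpa using (Complex.neg_pi_lt_arg w).le
  · fin_cases i
    · simpa using arccos_le_pi (x 2)
    · simpa using Complex.arg_le_pi w
  · ext i
    fin_cases i
    · simp [sphericalCoords, hsin, Complex.norm_mul_cos_arg, hw]
    · simp [sphericalCoords, hsin, Complex.norm_mul_sin_arg, hw]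
    · simpa [sphericalCoords] using
        cos_arccos (by nlinarith [sq_nonneg (x 0), sq_nonneg (x 1)])
          (by nlinarith [sq_nonneg (x 0), sq_nonneg (x 1)])

lemma hausdorffMeasure_sphere_lt_top : μH[2] (Metric.sphere (0 : E3) 1) < ⊤ := by
  obtain ⟨K, hK⟩ := contDiff_sphericalCoords.contDiffOn.exists_lipschitzOnWith
    one_ne_zero (convex_Icc (fun _ : Fin 2 => -π) (fun _ => π)) isCompact_Icc
  refine (measure_mono sphere_subset_image_sphericalCoords).trans_lt
    ((hK.hausdorffMeasure_image_le zero_le_two).trans_lt ?_)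
  have hvol : (μH[2] : Measure (Fin 2 → ℝ)) = volume := by
    simpa using hausdorffMeasure_pi_real (ι := Fin 2)
  rw [hvol]
  exact ENNReal.mul_lt_top (ENNReal.rpow_lt_top_of_nonneg zero_le_two ENNReal.coe_ne_top)
    isCompact_Icc.measure_lt_top

lemma norm_gradPhi_le {Γ μ δ : ℝ} (hΓ : 0 < Γ) (hμ : 0 < μ) (hδ₀ : 0 ≤ δ) (hδ₂ : δ ≤ 2)
    {z : E3} (hz : z ≠ 0) : ‖gradPhi Γ μ δ z‖ ≤ Γ / μ * ‖z‖ ^ (-1 - δ / 2) := by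
  have hr : 0 < ‖z‖ := norm_pos_iff.2 hz
  rw [gradPhi, norm_smul]
  set r := ‖z‖
  set D := r ^ 2 + μ ^ 2 * r ^ δ with hD
  have hDpos : 0 < D := by positivity
  have hfac : 2 + δ * μ ^ 2 * r ^ (δ - 2) ≤ 2 * D / r ^ 2 := by
    rw [rpow_sub hr, rpow_two, hD, le_div_iff₀ (by positivity)]
    have h : (2 + δ * μ ^ 2 * (r ^ δ / r ^ 2)) * r ^ 2 = 2 * r ^ 2 + δ * (μ ^ 2 * r ^ δ) := by
      field_simp
    rw [h]
    nlinarith [mul_le_mul_of_nonneg_right hδ₂ (by positivity : 0 ≤ μ ^ 2 * r ^ δ)]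
  have hroot : D ^ (-(1 : ℝ) / 2) ≤ μ⁻¹ * r ^ (-δ / 2) := by
    calc D ^ (-(1 : ℝ) / 2) ≤ (μ ^ 2 * r ^ δ) ^ (-(1 : ℝ) / 2) :=
          rpow_le_rpow_of_nonpos (by positivity) (by rw [hD]; nlinarith) (by norm_num)
      _ = μ⁻¹ * r ^ (-δ / 2) := by
          rw [mul_rpow (by positivity) (by positivity), ← rpow_natCast, ← rpow_mul hμ.le,
            ← rpow_mul hr.le, ← rpow_neg_one]
          congr 2 <;> push_cast <;> ring
  have hDmul : D * D ^ (-(3 : ℝ) / 2) = D ^ (-(1 : ℝ) / 2) := by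
    nth_rewrite 1 [← rpow_one D]
    rw [← rpow_add hDpos]
    norm_num
  have hnorm : ‖-(Γ / 2) * (2 + δ * μ ^ 2 * r ^ (δ - 2)) * D ^ (-(3 : ℝ) / 2)‖ =
      Γ / 2 * (2 + δ * μ ^ 2 * r ^ (δ - 2)) * D ^ (-(3 : ℝ) / 2) := by
    rw [neg_mul, neg_mul, norm_neg, norm_of_nonneg (by positivity)]
  rw [hnorm]
  calc Γ / 2 * (2 + δ * μ ^ 2 * r ^ (δ - 2)) * D ^ (-(3 : ℝ) / 2) * r
      ≤ Γ / 2 * (2 * D / r ^ 2) * D ^ (-(3 : ℝ) / 2) * r := by gcongr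
    _ = Γ / r * (D * D ^ (-(3 : ℝ) / 2)) := by field_simp
    _ ≤ Γ / r * (μ⁻¹ * r ^ (-δ / 2)) := by rw [hDmul]; gcongr
    _ = Γ / μ * r ^ (-1 - δ / 2) := by
        rw [show -1 - δ / 2 = -1 + -δ / 2 by ring, rpow_add hr, rpow_neg_one]
        ring

lemma abs_sphereTerm_le {Γ μ δ : ℝ} (hΓ : 0 < Γ) (hμ : 0 < μ) (hδ₀ : 0 ≤ δ) (hδ₂ : δ ≤ 2)
    {χ : E3 → ℝ} {S : ℝ} (hχ : ∀ x, |χ x| ≤ S) {ε : ℝ} (hε : 0 < ε) (i j : Fin 3) :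
    |sphereTerm Γ μ δ χ ε i j| ≤
      Γ / μ * (μH[2] : Measure E3).real (Metric.sphere 0 1) * ε ^ (1 - δ / 2) * S := by
  have hS : 0 ≤ S := (abs_nonneg _).trans (hχ 0)
  have hint := norm_setIntegral_le_of_norm_le_const (μ := (μH[2] : Measure E3))
    (s := Metric.sphere (0 : E3) 1)
    (f := fun x => χ (ε • x) * (gradPhi Γ μ δ (ε • x) i * x j))
    (C := S * (Γ / μ * ε ^ (-1 - δ / 2))) hausdorffMeasure_sphere_lt_top (by
      intro x hx
      have hx1 : ‖x‖ = 1 := mem_sphere_zero_iff_norm.1 hx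
      have hεx : ‖ε • x‖ = ε := by rw [norm_smul, hx1, mul_one, norm_of_nonneg hε.le]
      have hgrad := norm_gradPhi_le hΓ hμ hδ₀ hδ₂ (norm_pos_iff.1 (hε.trans_eq hεx.symm))
      rw [hεx] at hgrad
      rw [norm_mul, norm_mul]
      refine mul_le_mul (hχ _) ?_ (by positivity) hS
      calc ‖gradPhi Γ μ δ (ε • x) i‖ * ‖x j‖ ≤ ‖gradPhi Γ μ δ (ε • x)‖ * ‖x‖ :=
            mul_le_mul (PiLp.norm_apply_le _ i) (PiLp.norm_apply_le x j)
              (norm_nonneg _) (norm_nonneg _)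
        _ ≤ Γ / μ * ε ^ (-1 - δ / 2) := by rwa [hx1, mul_one])
  rw [sphereTerm, abs_mul, abs_of_nonneg (sq_nonneg ε)]
  refine (mul_le_mul_of_nonneg_left hint (sq_nonneg ε)).trans_eq ?_
  rw [show 1 - δ / 2 = (2 : ℝ) + (-1 - δ / 2) by ring, rpow_add hε, rpow_two]
  ring

theorem stmt5 (Γ μ δ : ℝ) (hΓ : 0 < Γ) (hμ : 0 < μ) (hδ : δ ∈ Set.Icc (0 : ℝ) (4 / 5)) :
    ∃ C > (0 : ℝ),
      ∀ χ : E3 → ℝ, Continuous χ → (∃ M : ℝ, ∀ x, |χ x| ≤ M) →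
        (∀ ε : ℝ, ε ∈ Set.Ioc (0 : ℝ) 1 → ∀ i j : Fin 3,
          |sphereTerm Γ μ δ χ ε i j| ≤ C * ε ^ (1 - δ / 2) * ⨆ x : E3, |χ x|) ∧
        (∀ i j : Fin 3,
          Tendsto (fun ε : ℝ => sphereTerm Γ μ δ χ ε i j) (nhdsWithin 0 (Set.Ioi 0))
            (nhds 0)) := by
  have hδ₂ : δ < 2 := hδ.2.trans_lt (by norm_num)
  have hm : 0 ≤ (μH[2] : Measure E3).real (Metric.sphere 0 1) := measureReal_nonneg
  set m := (μH[2] : Measure E3).real (Metric.sphere 0 1)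
  refine ⟨Γ / μ * (m + 1), by positivity, fun χ _ hb => ?_⟩
  obtain ⟨M, hM⟩ := hb
  have hbdd : BddAbove (Set.range fun x => |χ x|) := ⟨M, by rintro _ ⟨x, rfl⟩; exact hM x⟩
  refine ⟨fun ε hε i j => ?_, fun i j => ?_⟩
  · have hε₀ : 0 < ε := hε.1
    have hS : 0 ≤ ⨆ x : E3, |χ x| := Real.iSup_nonneg fun x => abs_nonneg _
    refine (abs_sphereTerm_le hΓ hμ hδ.1 hδ₂.le (le_ciSup hbdd) hε₀ i j).trans ?_
    gcongr
    linarith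
  · have hlim : Tendsto (fun ε : ℝ => Γ / μ * m * ε ^ (1 - δ / 2) * M)
        (nhdsWithin 0 (Set.Ioi 0)) (nhds 0) := by
      have hexp : 0 < 1 - δ / 2 := by linarith
      have hpow := (continuousAt_rpow_const 0 (1 - δ / 2) (Or.inr hexp.le)).tendsto
      rw [zero_rpow hexp.ne'] at hpow
      simpa using ((hpow.mono_left nhdsWithin_le_nhds).const_mul (Γ / μ * m)).mul_const M
    refine squeeze_zero_norm' ?_ hlim
    filter_upwards [self_mem_nhdsWithin] with ε hε
    exact abs_sphereTerm_le hΓ hμ hδ.1 hδ₂.le hM hε i j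
end
end

section
/- Fix Γ > 0, μ > 0 and δ ∈ [0, 4/5]. For every z ∈ ℝ³ with z ≠ 0 and every w ∈ ℝ³, let T be the 3×3 matrix with entries T_{ij} = Σ_{k,l} ε_{jkl} ∂_i ∂_k φ_δ(z) w_l (i.e. the i-th row of T is the cross product of the i-th row of the Hessian ∇∇φ_δ(z) with w, where ε is the Levi-Civita symbol). Then the symmetric part of T satisfies (T + Tᵀ)/2 = c(|z|) [ z ⊗ (z × w) + (z × w) ⊗ z ], where c(r) = (1/4) Γ δ(2−δ) μ² r^{δ−4} A(r)^{−3/2} + (3/8) Γ B(r)² A(r)^{−5/2}. -/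
open MeasureTheory Real

noncomputable section

/-- The cross product on `ℝ³`. -/
noncomputable def cross3 (a b : E3) : E3 :=
  (EuclideanSpace.equiv (Fin 3) ℝ).symm
    ![a 1 * b 2 - a 2 * b 1, a 2 * b 0 - a 0 * b 2, a 0 * b 1 - a 1 * b 0]

/-- The Levi-Civita symbol `ε_{ijk}` on `{0,1,2}`. -/
noncomputable def levi (i j k : Fin 3) : ℝ :=
  ((j : ℝ) - (i : ℝ)) * ((k : ℝ) - (j : ℝ)) * ((k : ℝ) - (i : ℝ)) / 2

/-- `A(r) = r² + μ² r^δ`. -/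
noncomputable def Afun (μ δ r : ℝ) : ℝ := r ^ 2 + μ ^ 2 * r ^ δ

/-- `B(r) = 2 + δ μ² r^{δ−2}`. -/
noncomputable def Bfun (μ δ r : ℝ) : ℝ := 2 + δ * μ ^ 2 * r ^ (δ - 2)

/-- The Hessian of `φ_δ`:
`∇∇φ_δ(z) = −(Γ/2) A(|z|)^{−3/2} [ B(|z|) Id + δ(δ−2) μ² |z|^{δ−4} z ⊗ z ]
            + (3Γ/4) A(|z|)^{−5/2} B(|z|)² z ⊗ z`. -/
noncomputable def hessPhi (Γ μ δ : ℝ) (z : E3) : Matrix (Fin 3) (Fin 3) ℝ :=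
  Matrix.of fun i j =>
    -(Γ / 2) * Afun μ δ ‖z‖ ^ (-(3 : ℝ) / 2) *
      (Bfun μ δ ‖z‖ * (if i = j then (1 : ℝ) else 0) +
        δ * (δ - 2) * μ ^ 2 * ‖z‖ ^ (δ - 4) * (z i * z j)) +
    3 * Γ / 4 * Afun μ δ ‖z‖ ^ (-(5 : ℝ) / 2) * Bfun μ δ ‖z‖ ^ 2 * (z i * z j)

/-- The kernel `c(r) = (1/4) Γ δ(2−δ) μ² r^{δ−4} A(r)^{−3/2} + (3/8) Γ B(r)² A(r)^{−5/2}`. -/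
noncomputable def cKer (Γ μ δ r : ℝ) : ℝ :=
  1 / 4 * Γ * δ * (2 - δ) * μ ^ 2 * r ^ (δ - 4) * Afun μ δ r ^ (-(3 : ℝ) / 2) +
  3 / 8 * Γ * Bfun μ δ r ^ 2 * Afun μ δ r ^ (-(5 : ℝ) / 2)

/-- `T_{ij} = Σ_{k,l} ε_{jkl} ∂_i ∂_k φ_δ(z) w_l`, i.e. the `i`-th row of `T` is the
cross product of the `i`-th row of the Hessian `∇∇φ_δ(z)` with `w`. -/
noncomputable def Tmat (Γ μ δ : ℝ) (z w : E3) : Matrix (Fin 3) (Fin 3) ℝ :=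
  Matrix.of fun i j => ∑ k : Fin 3, ∑ l : Fin 3, levi j k l * hessPhi Γ μ δ z i k * w l

theorem hessPhi_apply (Γ μ δ : ℝ) (z : E3) (i j : Fin 3) :
    hessPhi Γ μ δ z i j =
      -(Γ / 2) * Afun μ δ ‖z‖ ^ (-(3 : ℝ) / 2) * Bfun μ δ ‖z‖ * (if i = j then 1 else 0) +
        2 * cKer Γ μ δ ‖z‖ * (z i * z j) := by
  simp only [hessPhi, cKer, Matrix.of_apply]
  ring

theorem stmt7 (Γ μ δ : ℝ) (hΓ : 0 < Γ) (hμ : 0 < μ) (hδ : δ ∈ Set.Icc (0 : ℝ) (4 / 5))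
    (z : E3) (hz : z ≠ 0) (w : E3) :
    ∀ i j : Fin 3,
      (Tmat Γ μ δ z w i j + Tmat Γ μ δ z w j i) / 2 =
        cKer Γ μ δ ‖z‖ * (z i * cross3 z w j + cross3 z w i * z j) := by
  intro i j
  simp only [Tmat, Matrix.of_apply, hessPhi_apply]
  generalize cKer Γ μ δ ‖z‖ = c
  generalize -(Γ / 2) * Afun μ δ ‖z‖ ^ (-(3 : ℝ) / 2) * Bfun μ δ ‖z‖ = a
  fin_cases i <;> fin_cases j <;>
    simp [Fin.sum_univ_three, levi, cross3] <;> ring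
end
end

section
/- Fix Γ > 0, μ > 0 and δ ∈ [0, 4/5]. Let ω : ℝ³ → ℝ³ be continuous with compact support, and define the velocity u(x) = −(1/4π) ∫_{ℝ³} ∇φ_δ(x − y) × ω(y) dy. Then u is differentiable on ℝ³ and, for all i, j ∈ {1,2,3} and all x ∈ ℝ³, ∂_i u_j(x) = −(1/4π) ∫_{ℝ³} Σ_{k,l} ε_{jkl} ∂_i ∂_k φ_δ(x − y) ω_l(y) dy, where the integral on the right-hand side is absolutely convergent. -/
open MeasureTheory Real

noncomputable section

/-- The velocity field given by the approximate Biot–Savart law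
`u(x) = −(1/4π) ∫ ∇φ_δ(x − y) × ω(y) dy`. -/
noncomputable def biotSavart (Γ μ δ : ℝ) (ω : E3 → E3) (x : E3) : E3 :=
  (-(1 / (4 * π))) • ∫ y : E3, cross3 (gradPhi Γ μ δ (x - y)) (ω y)

/-- The standard basis vector `eᵢ` of `ℝ³`. -/
noncomputable def e3 (i : Fin 3) : E3 := EuclideanSpace.single i (1 : ℝ)

open Filter Topology Metric

theorem sub_mem_closedBall_zero {E : Type*} [SeminormedAddCommGroup E] {x x₀ y : E} {r R : ℝ}
    (hx : x ∈ ball x₀ r) (hy : y ∈ closedBall 0 R) : x - y ∈ closedBall 0 (‖x₀‖ + r + R) := by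
  rw [mem_closedBall_zero_iff] at hy ⊢
  rw [mem_ball_iff_norm] at hx
  linarith [norm_sub_le x y, norm_le_insert' x x₀]

theorem tendsto_setIntegral_norm_sub_of_dominated {E F : Type*} [MeasurableSpace E]
    [NormedAddCommGroup F] {ν : Measure E} {s : Set E} {hn : ℕ → E → F} {h : E → F}
    {b : E → ℝ} (hhn : ∀ n, AEStronglyMeasurable (hn n) ν) (hh : AEStronglyMeasurable h ν)
    (hb : IntegrableOn b s ν) (hbound : ∀ n, ∀ᵐ z ∂ν.restrict s, ‖hn n z‖ ≤ b z)
    (hlim : ∀ᵐ z ∂ν, Tendsto (fun n => hn n z) atTop (𝓝 (h z))) :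
    Tendsto (fun n => ∫ z in s, ‖hn n z - h z‖ ∂ν) atTop (𝓝 0) := by
  have hlim' := ae_restrict_of_ae (s := s) hlim
  have hall : ∀ᵐ z ∂ν.restrict s, ∀ n, ‖hn n z‖ ≤ b z := ae_all_iff.2 hbound
  have hle : ∀ᵐ z ∂ν.restrict s, ‖h z‖ ≤ b z := by
    filter_upwards [hlim', hall] with z hz hb
    exact le_of_tendsto hz.norm (.of_forall hb)
  have := tendsto_integral_of_dominated_convergence (μ := ν.restrict s)
    (F := fun n z => ‖hn n z - h z‖) (f := fun _ => 0) (fun z => b z + b z)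
    (fun n => ((hhn n).sub hh).norm.restrict) (hb.add hb) (fun n => ?_) ?_
  · simpa using this
  · filter_upwards [hbound n, hle] with z h1 h2
    rw [norm_norm]
    exact (norm_sub_le _ _).trans (add_le_add h1 h2)
  · filter_upwards [hlim'] with z hz
    simpa using (hz.sub_const (h z)).norm

section Convolution

variable {E F : Type*} [NormedAddCommGroup E] [NormedSpace ℝ E] [FiniteDimensional ℝ E]
  [MeasurableSpace E] [BorelSpace E] [NormedAddCommGroup F] [NormedSpace ℝ F]
  {ν : Measure E} [ν.IsAddHaarMeasure] {f : E → ℝ}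

theorem integrable_smul_comp_sub (hf : Continuous f) (hfs : HasCompactSupport f)
    {h : E → F} (hh : LocallyIntegrable h ν) (x : E) :
    Integrable (fun y => f y • h (x - y)) ν :=
  hfs.convolutionExists_left (ContinuousLinearMap.lsmul ℝ ℝ) hf hh x

/-- Convolution with a fixed test function turns local `L¹` convergence of kernels into uniform
convergence on balls. -/
theorem tendstoUniformlyOn_integral_smul_comp_sub (hf : Continuous f) (hfs : HasCompactSupport f)
    {hn : ℕ → E → F} {h : E → F} (hhn : ∀ n, LocallyIntegrable (hn n) ν)
    (hh : LocallyIntegrable h ν)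
    (hlim : ∀ R, Tendsto (fun n => ∫ z in closedBall 0 R, ‖hn n z - h z‖ ∂ν) atTop (𝓝 0))
    (x₀ : E) :
    TendstoUniformlyOn (fun n x => ∫ y, f y • hn n (x - y) ∂ν) (fun x => ∫ y, f y • h (x - y) ∂ν)
      atTop (ball x₀ 1) := by
  obtain ⟨M, hM⟩ := hf.bounded_above_of_compact_support hfs
  have hM0 : 0 ≤ M := (norm_nonneg _).trans (hM 0)
  obtain ⟨R₀, hR₀⟩ := hfs.isCompact.isBounded.subset_closedBall (0 : E)
  set R := ‖x₀‖ + 1 + R₀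
  have key : ∀ n, ∀ x ∈ ball x₀ 1,
      dist (∫ y, f y • h (x - y) ∂ν) (∫ y, f y • hn n (x - y) ∂ν)
        ≤ M * ∫ z in closedBall 0 R, ‖hn n z - h z‖ ∂ν := by
    intro n x hx
    have hd : LocallyIntegrable (fun z => hn n z - h z) ν := (hhn n).sub hh
    have hI : Integrable ((closedBall 0 R).indicator fun z => ‖hn n z - h z‖) ν :=
      (integrable_indicator_iff measurableSet_closedBall).2
        (hd.integrableOn_isCompact (isCompact_closedBall _ _)).norm
    rw [dist_comm, dist_eq_norm, ← integral_sub (integrable_smul_comp_sub hf hfs (hhn n) x)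
      (integrable_smul_comp_sub hf hfs hh x), ← integral_indicator measurableSet_closedBall,
      ← integral_sub_left_eq_self (Set.indicator _ _) ν x, ← integral_const_mul]
    refine norm_integral_le_of_norm_le ((hI.comp_sub_left x).const_mul M) (.of_forall fun y => ?_)
    rw [← smul_sub, norm_smul]
    by_cases hy : f y = 0
    · rw [hy, norm_zero, zero_mul]
      exact mul_nonneg hM0 (Set.indicator_nonneg (fun _ _ => norm_nonneg _) _)
    · have hxy : x - y ∈ closedBall (0 : E) R :=
        sub_mem_closedBall_zero hx (hR₀ (subset_tsupport f hy))
      rw [Set.indicator_of_mem hxy]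
      exact mul_le_mul_of_nonneg_right (hM y) (norm_nonneg _)
  rw [Metric.tendstoUniformlyOn_iff]
  intro ε hε
  have h0 : Tendsto (fun n => M * ∫ z in closedBall 0 R, ‖hn n z - h z‖ ∂ν) atTop (𝓝 0) := by
    simpa using (hlim R).const_mul M
  filter_upwards [h0.eventually_lt_const hε] with n hn x hx
  exact (key n x hx).trans_lt hn

theorem hasFDerivAt_integral_mul_comp_sub_of_continuous (hf : Continuous f)
    (hfs : HasCompactSupport f) {k : E → ℝ} {k' : E → E →L[ℝ] ℝ}
    (hk : ∀ z, HasFDerivAt k (k' z) z) (hk' : Continuous k') (x₀ : E) :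
    HasFDerivAt (fun x => ∫ y, f y • k (x - y) ∂ν) (∫ y, f y • k' (x₀ - y) ∂ν) x₀ := by
  obtain ⟨R₀, hR₀⟩ := hfs.isCompact.isBounded.subset_closedBall (0 : E)
  set R := ‖x₀‖ + 1 + R₀
  obtain ⟨M, hM⟩ := (isCompact_closedBall (0 : E) R).exists_bound_of_continuousOn hk'.continuousOn
  have hkc : Continuous k := continuous_iff_continuousAt.2 fun z => (hk z).continuousAt
  refine hasFDerivAt_integral_of_dominated_of_fderiv_le (bound := fun y => ‖f y‖ * M)
    (F := fun x y => f y • k (x - y)) (F' := fun x y => f y • k' (x - y))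
    (ball_mem_nhds x₀ one_pos) (.of_forall fun x => ?_)
    (integrable_smul_comp_sub hf hfs hkc.locallyIntegrable x₀)
    (integrable_smul_comp_sub hf hfs hk'.locallyIntegrable x₀).aestronglyMeasurable
    (.of_forall fun y x hx => ?_) ((hf.integrable_of_hasCompactSupport hfs).norm.mul_const M)
    (.of_forall fun y x _ => ?_)
  · exact (integrable_smul_comp_sub hf hfs hkc.locallyIntegrable x).aestronglyMeasurable
  · rw [norm_smul]
    by_cases hy : f y = 0
    · simp [hy]
    · have hxy : x - y ∈ closedBall (0 : E) R :=
        sub_mem_closedBall_zero hx (hR₀ (subset_tsupport f hy))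
      exact mul_le_mul_of_nonneg_left (hM _ hxy) (norm_nonneg _)
  · have := ((hk (x - y)).comp x ((hasFDerivAt_id x).sub_const y)).const_smul (f y)
    rwa [ContinuousLinearMap.comp_id] at this

/-- Differentiation of a convolution whose kernel is a dominated almost everywhere limit of
continuously differentiable kernels. -/
theorem hasFDerivAt_integral_mul_comp_sub (hf : Continuous f) (hfs : HasCompactSupport f)
    {kn : ℕ → E → ℝ} {kn' : ℕ → E → E →L[ℝ] ℝ} {k : E → ℝ} {k' : E → E →L[ℝ] ℝ}
    (hkn : ∀ n z, HasFDerivAt (kn n) (kn' n z) z) (hkn' : ∀ n, Continuous (kn' n))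
    (hk : LocallyIntegrable k ν) (hk' : LocallyIntegrable k' ν)
    (hlim : ∀ᵐ z ∂ν, Tendsto (fun n => kn n z) atTop (𝓝 (k z)))
    (hlim' : ∀ᵐ z ∂ν, Tendsto (fun n => kn' n z) atTop (𝓝 (k' z)))
    (hbound : ∀ R, ∃ b : E → ℝ, IntegrableOn b (closedBall 0 R) ν ∧
      ∀ n, ∀ᵐ z ∂ν.restrict (closedBall 0 R), ‖kn n z‖ ≤ b z ∧ ‖kn' n z‖ ≤ b z) (x : E) :
    HasFDerivAt (fun x => ∫ y, f y • k (x - y) ∂ν) (∫ y, f y • k' (x - y) ∂ν) x := by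
  have hc : ∀ n, Continuous (kn n) := fun n =>
    continuous_iff_continuousAt.2 fun z => (hkn n z).continuousAt
  refine hasFDerivAt_of_tendstoUniformlyOn (l := atTop) (isOpen_ball (x := x) (ε := 1))
    (tendstoUniformlyOn_integral_smul_comp_sub hf hfs (fun n => (hkn' n).locallyIntegrable) hk'
      (fun R => ?_) x)
    (fun n z _ => hasFDerivAt_integral_mul_comp_sub_of_continuous hf hfs (hkn n) (hkn' n) z)
    (fun z hz => (tendstoUniformlyOn_integral_smul_comp_sub hf hfs
      (fun n => (hc n).locallyIntegrable) hk (fun R => ?_) x).tendsto_at hz)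
    (mem_ball_self one_pos)
  all_goals obtain ⟨b, hb, hb'⟩ := hbound R
  · exact tendsto_setIntegral_norm_sub_of_dominated (fun n => (hkn' n).aestronglyMeasurable)
      hk'.aestronglyMeasurable hb (fun n => (hb' n).mono fun _ h => h.2) hlim'
  · exact tendsto_setIntegral_norm_sub_of_dominated (fun n => (hc n).aestronglyMeasurable)
      hk.aestronglyMeasurable hb (fun n => (hb' n).mono fun _ h => h.1) hlim

end Convolution

section RadialKernel

variable {E : Type*} [NormedAddCommGroup E] [InnerProductSpace ℝ E]

/-- The kernel `g(|z|² + ε) ℓ(z)`. -/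
def radialKernel (g : ℝ → ℝ) (ℓ : E →L[ℝ] ℝ) (ε : ℝ) (z : E) : ℝ := g (‖z‖ ^ 2 + ε) * ℓ z

/-- The derivative of `radialKernel g ℓ ε`, where `g'` is the derivative of `g`. -/
def radialKernelFDeriv (g g' : ℝ → ℝ) (ℓ : E →L[ℝ] ℝ) (ε : ℝ) (z : E) : E →L[ℝ] ℝ :=
  g (‖z‖ ^ 2 + ε) • ℓ + ℓ z • g' (‖z‖ ^ 2 + ε) • 2 • innerSL ℝ z

variable {g g' : ℝ → ℝ} {ℓ : E →L[ℝ] ℝ} {ε : ℝ}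

theorem hasFDerivAt_radialKernel (hg : ∀ s, 0 < s → HasDerivAt g (g' s) s) {z : E}
    (hz : 0 < ‖z‖ ^ 2 + ε) :
    HasFDerivAt (radialKernel g ℓ ε) (radialKernelFDeriv g g' ℓ ε z) z := by
  have h1 : HasFDerivAt (fun z : E => ‖z‖ ^ 2 + ε) (2 • innerSL ℝ z) z := by
    simpa using ((hasStrictFDerivAt_norm_sq z).hasFDerivAt.add_const ε)
  exact ((hg _ hz).comp_hasFDerivAt z h1).mul ℓ.hasFDerivAt

theorem continuousAt_radialKernelFDeriv {α : Type*} [TopologicalSpace α] {a : α} {e : α → ℝ}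
    {w : α → E} (hg : ∀ s, 0 < s → HasDerivAt g (g' s) s) (hg' : ContinuousOn g' (Set.Ioi 0))
    (he : ContinuousAt e a) (hw : ContinuousAt w a) (ha : 0 < ‖w a‖ ^ 2 + e a) :
    ContinuousAt (fun x => radialKernelFDeriv g g' ℓ (e x) (w x)) a := by
  have hs : ContinuousAt (fun x => ‖w x‖ ^ 2 + e x) a := (hw.norm.pow 2).add he
  have h1 : ContinuousAt (fun x => g (‖w x‖ ^ 2 + e x)) a :=
    ContinuousAt.comp (f := fun x => ‖w x‖ ^ 2 + e x) (hg _ ha).continuousAt hs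
  have h2 : ContinuousAt (fun x => g' (‖w x‖ ^ 2 + e x)) a :=
    ContinuousAt.comp (f := fun x => ‖w x‖ ^ 2 + e x) (hg'.continuousAt (Ioi_mem_nhds ha)) hs
  have h3 : ContinuousAt (fun x => innerSL ℝ (w x)) a := (innerSL ℝ).continuous.continuousAt.comp hw
  exact (h1.smul continuousAt_const).add
    ((ℓ.continuous.continuousAt.comp hw).smul (h2.smul (h3.const_smul 2)))

theorem norm_radialKernel_le {p C R : ℝ} (hp : 0 ≤ p)
    (hC : ∀ s ∈ Set.Ioc 0 (R ^ 2 + 1), |g s| ≤ C * s ^ (-p) ∧ |g' s| ≤ C * s ^ (-p - 1))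
    (hε : ε ∈ Set.Icc (0 : ℝ) 1) {z : E} (hz : z ≠ 0) (hzR : ‖z‖ ≤ R) :
    ‖radialKernel g ℓ ε z‖ ≤ C * ‖ℓ‖ * (R + 3) * ‖z‖ ^ (-(2 * p)) ∧
    ‖radialKernelFDeriv g g' ℓ ε z‖ ≤ C * ‖ℓ‖ * (R + 3) * ‖z‖ ^ (-(2 * p)) := by
  have hz0 : 0 < ‖z‖ := norm_pos_iff.2 hz
  have hR : 0 < R := hz0.trans_le hzR
  set s := ‖z‖ ^ 2 + ε
  have hzs : ‖z‖ ^ 2 ≤ s := le_add_of_nonneg_right hε.1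
  have hs0 : 0 < s := (by positivity : 0 < ‖z‖ ^ 2).trans_le hzs
  have hsR : s ≤ R ^ 2 + 1 := add_le_add (by gcongr) hε.2
  obtain ⟨h1, h2⟩ := hC s ⟨hs0, hsR⟩
  have hC0 : 0 ≤ C :=
    nonneg_of_mul_nonneg_left ((abs_nonneg _).trans h1) (by positivity)
  have hpow : s ^ (-p) ≤ ‖z‖ ^ (-(2 * p)) := by
    have := rpow_le_rpow_of_nonpos (z := -p) (by positivity : 0 < ‖z‖ ^ 2) hzs (by linarith)
    rwa [← rpow_natCast, ← rpow_mul hz0.le, Nat.cast_ofNat, mul_neg] at this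
  have hpow1 : s ^ (-p - 1) * ‖z‖ ^ 2 ≤ ‖z‖ ^ (-(2 * p)) := by
    calc s ^ (-p - 1) * ‖z‖ ^ 2 ≤ s ^ (-p - 1) * s := by gcongr
      _ = s ^ (-p) := by rw [rpow_sub_one hs0.ne', div_mul_cancel₀ _ hs0.ne']
      _ ≤ _ := hpow
  have hℓ := ℓ.le_opNorm z
  set P := ‖z‖ ^ (-(2 * p))
  have hP : 0 ≤ P := by positivity
  have hg1 : |g s| ≤ C * P := h1.trans (by gcongr)
  constructor
  · calc ‖radialKernel g ℓ ε z‖ = |g s| * ‖ℓ z‖ := norm_mul _ _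
      _ ≤ C * P * (‖ℓ‖ * R) := by gcongr; exact hℓ.trans (by gcongr)
      _ ≤ C * ‖ℓ‖ * (R + 3) * P := by
        have : 0 ≤ C * P * ‖ℓ‖ := by positivity
        nlinarith
  · calc ‖radialKernelFDeriv g g' ℓ ε z‖
        ≤ |g s| * ‖ℓ‖ + ‖ℓ z‖ * (|g' s| * (2 * ‖z‖)) := by
          have h3 : ‖g s • ℓ‖ = |g s| * ‖ℓ‖ := norm_smul _ _
          have h4 : ‖ℓ z • g' s • 2 • innerSL ℝ z‖ = ‖ℓ z‖ * (|g' s| * (2 * ‖z‖)) := by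
            rw [norm_smul, norm_smul, RCLike.norm_nsmul ℝ, innerSL_apply_norm, nsmul_eq_mul]
            rfl
          rw [← h3, ← h4]
          exact norm_add_le _ _
      _ ≤ C * P * ‖ℓ‖ + ‖ℓ‖ * ‖z‖ * (C * s ^ (-p - 1) * (2 * ‖z‖)) := by gcongr
      _ = C * P * ‖ℓ‖ + 2 * (C * ‖ℓ‖) * (s ^ (-p - 1) * ‖z‖ ^ 2) := by ring
      _ ≤ C * P * ‖ℓ‖ + 2 * (C * ‖ℓ‖) * P := by gcongr
      _ ≤ C * ‖ℓ‖ * (R + 3) * P := by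
        have : 0 ≤ C * ‖ℓ‖ * P * R := by positivity
        linarith

variable [FiniteDimensional ℝ E] [MeasurableSpace E] [BorelSpace E] {ν : Measure E}
  [ν.IsAddHaarMeasure]

theorem integrableOn_norm_rpow_closedBall [Nontrivial E] {q : ℝ}
    (hq : q < Module.finrank ℝ E) (R : ℝ) :
    IntegrableOn (fun z : E => ‖z‖ ^ (-q)) (closedBall 0 R) ν := by
  have hR : 0 < |R| + 1 := by positivity
  refine IntegrableOn.mono_set (t := ball 0 (|R| + 1)) ?_
    (closedBall_subset_ball ((le_abs_self R).trans_lt (lt_add_one _)))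
  rw [integrableOn_fun_norm_addHaar ν (f := fun r : ℝ => r ^ (-q))]
  have hd : 1 ≤ Module.finrank ℝ E := Module.finrank_pos
  refine ((intervalIntegral.integrableOn_Ioo_rpow_iff
    (s := Module.finrank ℝ E - 1 - q) hR).2 (by linarith)).congr_fun (fun r hr => ?_)
    measurableSet_Ioo
  rw [smul_eq_mul, ← rpow_natCast, ← rpow_add hr.1, Nat.cast_sub hd, Nat.cast_one, sub_eq_add_neg]

theorem locallyIntegrable_of_norm_le_norm_rpow [Nontrivial E] {F : Type*} [NormedAddCommGroup F]
    {h : E → F} {q : ℝ} (hq : q < Module.finrank ℝ E) (hh : ContinuousOn h {0}ᶜ)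
    (hb : ∀ R, ∃ C, ∀ z ≠ 0, ‖z‖ ≤ R → ‖h z‖ ≤ C * ‖z‖ ^ (-q)) : LocallyIntegrable h ν := by
  have hm : AEStronglyMeasurable h ν := by
    rw [← restrict_compl_singleton (μ := ν) 0]
    exact hh.aestronglyMeasurable (measurableSet_singleton _).compl
  rw [locallyIntegrable_iff]
  intro K hK
  obtain ⟨R, hR⟩ := hK.isBounded.subset_closedBall (0 : E)
  obtain ⟨C, hC⟩ := hb R
  refine IntegrableOn.mono_set ?_ hR
  refine ((integrableOn_norm_rpow_closedBall hq R).const_mul C).mono' hm.restrict ?_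
  filter_upwards [ae_restrict_mem measurableSet_closedBall, ae_restrict_of_ae (ν.ae_ne 0)]
    with z hz hz0
  exact hC z hz0 (mem_closedBall_zero_iff.1 hz)

variable {f : E → ℝ} {p : ℝ} [Nontrivial E]

theorem locallyIntegrable_radialKernel (hp0 : 0 ≤ p) (hp : 2 * p < Module.finrank ℝ E)
    (hg : ∀ s, 0 < s → HasDerivAt g (g' s) s)
    (hb : ∀ S, ∃ C, ∀ s ∈ Set.Ioc 0 S, |g s| ≤ C * s ^ (-p) ∧ |g' s| ≤ C * s ^ (-p - 1)) :
    LocallyIntegrable (radialKernel g ℓ 0) ν := by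
  refine locallyIntegrable_of_norm_le_norm_rpow hp (fun z hz => ?_) fun R => ?_
  · have : z ≠ 0 := hz
    exact (hasFDerivAt_radialKernel hg (by positivity)).continuousAt.continuousWithinAt
  · obtain ⟨C, hC⟩ := hb (R ^ 2 + 1)
    exact ⟨_, fun z hz hzR => (norm_radialKernel_le hp0 hC (by simp) hz hzR).1⟩

theorem locallyIntegrable_radialKernelFDeriv (hp0 : 0 ≤ p) (hp : 2 * p < Module.finrank ℝ E)
    (hg : ∀ s, 0 < s → HasDerivAt g (g' s) s) (hg' : ContinuousOn g' (Set.Ioi 0))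
    (hb : ∀ S, ∃ C, ∀ s ∈ Set.Ioc 0 S, |g s| ≤ C * s ^ (-p) ∧ |g' s| ≤ C * s ^ (-p - 1)) :
    LocallyIntegrable (radialKernelFDeriv g g' ℓ 0) ν := by
  refine locallyIntegrable_of_norm_le_norm_rpow hp (fun z hz => ?_) fun R => ?_
  · have : z ≠ 0 := hz
    exact (continuousAt_radialKernelFDeriv hg hg' continuousAt_const continuousAt_id
      (by simp; positivity)).continuousWithinAt
  · obtain ⟨C, hC⟩ := hb (R ^ 2 + 1)
    exact ⟨_, fun z hz hzR => (norm_radialKernel_le hp0 hC (by simp) hz hzR).2⟩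

theorem hasFDerivAt_integral_radialKernel (hf : Continuous f) (hfs : HasCompactSupport f)
    (hp0 : 0 ≤ p) (hp : 2 * p < Module.finrank ℝ E)
    (hg : ∀ s, 0 < s → HasDerivAt g (g' s) s) (hg' : ContinuousOn g' (Set.Ioi 0))
    (hb : ∀ S, ∃ C, ∀ s ∈ Set.Ioc 0 S, |g s| ≤ C * s ^ (-p) ∧ |g' s| ≤ C * s ^ (-p - 1)) (x : E) :
    HasFDerivAt (fun x => ∫ y, f y • radialKernel g ℓ 0 (x - y) ∂ν)
      (∫ y, f y • radialKernelFDeriv g g' ℓ 0 (x - y) ∂ν) x := by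
  have hε : ∀ n : ℕ, (0 : ℝ) < 1 / ((n : ℝ) + 1) := fun n => Nat.one_div_pos_of_nat
  have hε0 : Tendsto (fun n : ℕ => 1 / ((n : ℝ) + 1)) atTop (𝓝 0) :=
    tendsto_one_div_add_atTop_nhds_zero_nat
  refine hasFDerivAt_integral_mul_comp_sub hf hfs
    (kn := fun n => radialKernel g ℓ (1 / ((n : ℝ) + 1)))
    (kn' := fun n => radialKernelFDeriv g g' ℓ (1 / ((n : ℝ) + 1)))
    (fun n z => hasFDerivAt_radialKernel hg (by positivity))
    (fun n => continuous_iff_continuousAt.2 fun z =>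
      continuousAt_radialKernelFDeriv hg hg' continuousAt_const continuousAt_id (by positivity))
    (locallyIntegrable_radialKernel hp0 hp hg hb)
    (locallyIntegrable_radialKernelFDeriv hp0 hp hg hg' hb) ?_ ?_ (fun R => ?_) x
  · filter_upwards [ν.ae_ne 0] with z hz
    have hz' : 0 < ‖z‖ ^ 2 + 0 := by positivity
    exact ((hg _ hz').continuousAt.tendsto.comp (hε0.const_add (‖z‖ ^ 2))).mul_const (ℓ z)
  · filter_upwards [ν.ae_ne 0] with z hz
    have hc : ContinuousAt (fun e => radialKernelFDeriv g g' ℓ e z) 0 :=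
      continuousAt_radialKernelFDeriv hg hg' continuousAt_id continuousAt_const
        (by simp; positivity)
    exact hc.tendsto.comp hε0
  · obtain ⟨C, hC⟩ := hb (R ^ 2 + 1)
    refine ⟨_, (integrableOn_norm_rpow_closedBall hp R).const_mul (C * ‖ℓ‖ * (R + 3)), fun n => ?_⟩
    filter_upwards [ae_restrict_mem measurableSet_closedBall, ae_restrict_of_ae (ν.ae_ne 0)]
      with z hz hz0
    refine norm_radialKernel_le hp0 hC ⟨(hε n).le, ?_⟩ hz0 (mem_closedBall_zero_iff.1 hz)
    rw [div_le_one (by positivity)]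
    linarith [n.cast_nonneg (α := ℝ)]

end RadialKernel

section Profile

/-- The function `g` with `∇φ_δ(z) = g(|z|²) z`. -/
def profile (Γ μ δ s : ℝ) : ℝ :=
  -(Γ / 2) * (2 + δ * μ ^ 2 * s ^ (δ / 2 - 1)) * (s + μ ^ 2 * s ^ (δ / 2)) ^ (-(3 : ℝ) / 2)

/-- The derivative of `profile`. -/
def profileDeriv (Γ μ δ s : ℝ) : ℝ :=
  -(Γ / 2) * (δ * (δ / 2 - 1) * μ ^ 2 * s ^ (δ / 2 - 2) *
      (s + μ ^ 2 * s ^ (δ / 2)) ^ (-(3 : ℝ) / 2) -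
    3 / 4 * (2 + δ * μ ^ 2 * s ^ (δ / 2 - 1)) ^ 2 *
      (s + μ ^ 2 * s ^ (δ / 2)) ^ (-(5 : ℝ) / 2))

variable {Γ μ δ s : ℝ}

theorem hasDerivAt_profile (hs : 0 < s) :
    HasDerivAt (profile Γ μ δ) (profileDeriv Γ μ δ s) s := by
  have hA : 0 < s + μ ^ 2 * s ^ (δ / 2) := by positivity
  have h1 : HasDerivAt (fun s => 2 + δ * μ ^ 2 * s ^ (δ / 2 - 1))
      (δ * μ ^ 2 * ((δ / 2 - 1) * s ^ (δ / 2 - 1 - 1))) s :=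
    ((hasDerivAt_rpow_const (.inl hs.ne')).const_mul _).const_add _
  have h2 : HasDerivAt (fun s => s + μ ^ 2 * s ^ (δ / 2))
      (1 + μ ^ 2 * (δ / 2 * s ^ (δ / 2 - 1))) s :=
    (hasDerivAt_id s).add ((hasDerivAt_rpow_const (.inl hs.ne')).const_mul _)
  have h3 := (h1.const_mul (-(Γ / 2))).mul (h2.rpow_const (p := -(3 : ℝ) / 2) (.inl hA.ne'))
  refine h3.congr_deriv ?_
  rw [profileDeriv, show δ / 2 - 1 - 1 = δ / 2 - 2 by ring,
    show -(3 : ℝ) / 2 - 1 = -(5 : ℝ) / 2 by ring]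
  ring

theorem continuousOn_profileDeriv : ContinuousOn (profileDeriv Γ μ δ) (Set.Ioi 0) := by
  intro s hs
  have hs : 0 < s := hs
  have hA : s + μ ^ 2 * s ^ (δ / 2) ≠ 0 := by positivity
  have hr : ∀ q : ℝ, ContinuousAt (fun s : ℝ => s ^ q) s := fun q =>
    continuousAt_rpow_const _ _ (.inl hs.ne')
  have hAc : ContinuousAt (fun s : ℝ => s + μ ^ 2 * s ^ (δ / 2)) s :=
    continuousAt_id.add ((hr _).const_mul _)
  have hAr : ∀ q : ℝ, ContinuousAt (fun s : ℝ => (s + μ ^ 2 * s ^ (δ / 2)) ^ q) s := fun q =>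
    hAc.rpow_const (.inl hA)
  have hB : ContinuousAt (fun s : ℝ => 2 + δ * μ ^ 2 * s ^ (δ / 2 - 1)) s :=
    ((hr _).const_mul _).const_add _
  exact (((((hr _).const_mul _).mul (hAr _)).sub
    (((hB.pow 2).const_mul _).mul (hAr _))).const_mul _).continuousWithinAt

theorem profile_bound (hμ : 0 < μ) (hδ : δ ∈ Set.Icc (0 : ℝ) 2) (S : ℝ) :
    ∃ C, ∀ s ∈ Set.Ioc 0 S, |profile Γ μ δ s| ≤ C * s ^ (-(1 + δ / 4)) ∧
      |profileDeriv Γ μ δ s| ≤ C * s ^ (-(1 + δ / 4) - 1) := by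
  obtain ⟨hδ0, hδ2⟩ := hδ
  set b := 2 * S ^ (1 - δ / 2) + δ * μ ^ 2 with hb
  set a3 := (μ ^ 2) ^ (-(3 : ℝ) / 2)
  set a5 := (μ ^ 2) ^ (-(5 : ℝ) / 2)
  have ha3 : 0 < a3 := by positivity
  have ha5 : 0 < a5 := by positivity
  refine ⟨|Γ / 2| * (b * a3) + |Γ / 2| * (|δ * (δ / 2 - 1) * μ ^ 2| * a3 + 3 / 4 * b ^ 2 * a5),
    fun s ⟨hs, hsS⟩ => ?_⟩
  have hS : 0 < S := hs.trans_le hsS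
  have hb0 : 0 ≤ b := by positivity
  have hA : ∀ q ≤ (0 : ℝ), (s + μ ^ 2 * s ^ (δ / 2)) ^ q ≤ (μ ^ 2) ^ q * s ^ (δ / 2 * q) := by
    intro q hq
    rw [rpow_mul hs.le, ← mul_rpow (by positivity) (by positivity)]
    exact rpow_le_rpow_of_nonpos (by positivity) (le_add_of_nonneg_left hs.le) hq
  have hA3 := hA (-(3 : ℝ) / 2) (by norm_num)
  have hA5 := hA (-(5 : ℝ) / 2) (by norm_num)
  have hB0 : 0 ≤ 2 + δ * μ ^ 2 * s ^ (δ / 2 - 1) := by positivity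
  have hB : 2 + δ * μ ^ 2 * s ^ (δ / 2 - 1) ≤ b * s ^ (δ / 2 - 1) := by
    have h1 : (1 : ℝ) ≤ S ^ (1 - δ / 2) * s ^ (δ / 2 - 1) := by
      calc (1 : ℝ) = s ^ (1 - δ / 2) * s ^ (δ / 2 - 1) := by rw [← rpow_add hs]; simp
        _ ≤ S ^ (1 - δ / 2) * s ^ (δ / 2 - 1) := by gcongr; linarith
    rw [hb]; linarith
  set A3 := (s + μ ^ 2 * s ^ (δ / 2)) ^ (-(3 : ℝ) / 2) with hA3'
  set A5 := (s + μ ^ 2 * s ^ (δ / 2)) ^ (-(5 : ℝ) / 2) with hA5'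
  set B := 2 + δ * μ ^ 2 * s ^ (δ / 2 - 1) with hB'
  have hA30 : 0 ≤ A3 := by positivity
  have hA50 : 0 ≤ A5 := by positivity
  have e1 : s ^ (δ / 2 - 1) * s ^ (δ / 2 * (-(3 : ℝ) / 2)) = s ^ (-(1 + δ / 4)) := by
    rw [← rpow_add hs]; ring_nf
  have e2 : s ^ (δ / 2 - 2) * s ^ (δ / 2 * (-(3 : ℝ) / 2)) = s ^ (-(1 + δ / 4) - 1) := by
    rw [← rpow_add hs]; ring_nf
  have e3 : (s ^ (δ / 2 - 1)) ^ 2 * s ^ (δ / 2 * (-(5 : ℝ) / 2)) = s ^ (-(1 + δ / 4) - 1) := by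
    rw [← rpow_natCast, ← rpow_mul hs.le, ← rpow_add hs]; push_cast; ring_nf
  have hC1 : 0 ≤ |Γ / 2| * (b * a3) := by positivity
  have hC2 : 0 ≤ |Γ / 2| * (|δ * (δ / 2 - 1) * μ ^ 2| * a3 + 3 / 4 * b ^ 2 * a5) := by positivity
  constructor
  · calc |profile Γ μ δ s| = |Γ / 2| * (B * A3) := by
          rw [profile, ← hA3', ← hB', abs_mul, abs_mul, abs_neg, abs_of_nonneg hB0,
            abs_of_nonneg hA30, mul_assoc]
      _ ≤ |Γ / 2| * (b * s ^ (δ / 2 - 1) * (a3 * s ^ (δ / 2 * (-(3 : ℝ) / 2)))) := by gcongr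
      _ = |Γ / 2| * (b * a3) * s ^ (-(1 + δ / 4)) := by rw [← e1]; ring
      _ ≤ _ := by gcongr; linarith
  · calc |profileDeriv Γ μ δ s|
        ≤ |Γ / 2| * (|δ * (δ / 2 - 1) * μ ^ 2| * s ^ (δ / 2 - 2) * A3 + 3 / 4 * B ^ 2 * A5) := by
          rw [profileDeriv, ← hA3', ← hB', ← hA5', abs_mul, abs_neg]
          gcongr
          refine (abs_sub _ _).trans (add_le_add ?_ ?_)
          · rw [abs_mul, abs_mul, abs_of_nonneg hA30, abs_of_nonneg (rpow_nonneg hs.le _)]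
          · rw [abs_of_nonneg (by positivity)]
      _ ≤ |Γ / 2| * (|δ * (δ / 2 - 1) * μ ^ 2| * s ^ (δ / 2 - 2) *
            (a3 * s ^ (δ / 2 * (-(3 : ℝ) / 2))) +
            3 / 4 * (b * s ^ (δ / 2 - 1)) ^ 2 * (a5 * s ^ (δ / 2 * (-(5 : ℝ) / 2)))) := by gcongr
      _ = |Γ / 2| * (|δ * (δ / 2 - 1) * μ ^ 2| * a3 *
            (s ^ (δ / 2 - 2) * s ^ (δ / 2 * (-(3 : ℝ) / 2))) + 3 / 4 * b ^ 2 * a5 *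
            ((s ^ (δ / 2 - 1)) ^ 2 * s ^ (δ / 2 * (-(5 : ℝ) / 2)))) := by ring
      _ = |Γ / 2| * (|δ * (δ / 2 - 1) * μ ^ 2| * a3 + 3 / 4 * b ^ 2 * a5) *
            s ^ (-(1 + δ / 4) - 1) := by rw [e2, e3]; ring
      _ ≤ _ := by gcongr; linarith

end Profile

section BiotSavart

variable {Γ μ δ : ℝ}

theorem sq_norm_rpow {E : Type*} [SeminormedAddCommGroup E] (z : E) (q : ℝ) :
    (‖z‖ ^ 2) ^ q = ‖z‖ ^ (2 * q) := by
  rw [rpow_mul (norm_nonneg z), rpow_ofNat]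

theorem gradPhi_apply (z : E3) (k : Fin 3) :
    gradPhi Γ μ δ z k = radialKernel (profile Γ μ δ) (EuclideanSpace.proj k) 0 z := by
  simp only [gradPhi, radialKernel, profile, add_zero, sq_norm_rpow, PiLp.smul_apply, smul_eq_mul,
    PiLp.proj_apply]
  ring_nf

theorem hessPhi_apply_s8 (z : E3) (i k : Fin 3) :
    hessPhi Γ μ δ z i k =
      radialKernelFDeriv (profile Γ μ δ) (profileDeriv Γ μ δ) (EuclideanSpace.proj k) 0 z
        (e3 i) := by
  have h : inner ℝ z (e3 i) = z i := by simp [e3, EuclideanSpace.inner_single_right]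
  have h' : (e3 i : E3) k = if i = k then 1 else 0 := by simp [e3, eq_comm]
  simp only [hessPhi, Matrix.of_apply, Afun, Bfun, radialKernelFDeriv, profile, profileDeriv,
    add_zero, sq_norm_rpow, add_apply, smul_apply,
    innerSL_apply_apply, h, h', smul_eq_mul, PiLp.proj_apply, nsmul_eq_mul]
  rw [show 2 * (δ / 2) = δ by ring, show 2 * (δ / 2 - 1) = δ - 2 by ring,
    show 2 * (δ / 2 - 2) = δ - 4 by ring]
  push_cast
  ring

theorem cross3_apply (a b : E3) (j : Fin 3) :
    cross3 a b j = ∑ k, ∑ l, levi j k l * a k * b l := by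
  fin_cases j <;> simp [cross3, levi, Fin.sum_univ_three] <;> ring

end BiotSavart

theorem stmt8 (Γ μ δ : ℝ) (hΓ : 0 < Γ) (hμ : 0 < μ) (hδ : δ ∈ Set.Icc (0 : ℝ) (4 / 5))
    (ω : E3 → E3) (hω : Continuous ω) (hωsupp : HasCompactSupport ω) :
    (∀ x : E3, DifferentiableAt ℝ (biotSavart Γ μ δ ω) x) ∧
    (∀ x : E3, ∀ i j : Fin 3,
      Integrable
        (fun y : E3 => ∑ k : Fin 3, ∑ l : Fin 3,
          levi j k l * hessPhi Γ μ δ (x - y) i k * ω y l) volume ∧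
      fderiv ℝ (fun x' : E3 => biotSavart Γ μ δ ω x' j) x (e3 i) =
        -(1 / (4 * π)) * ∫ y : E3, ∑ k : Fin 3, ∑ l : Fin 3,
          levi j k l * hessPhi Γ μ δ (x - y) i k * ω y l) := by
  have hp0 : 0 ≤ 1 + δ / 4 := by linarith [hδ.1]
  have hp : 2 * (1 + δ / 4) < Module.finrank ℝ E3 := by
    rw [finrank_euclideanSpace_fin]; push_cast; linarith [hδ.2]
  have hb := profile_bound (Γ := Γ) hμ ⟨hδ.1, hδ.2.trans (by norm_num)⟩
  have hg : ∀ s, 0 < s → HasDerivAt (profile Γ μ δ) (profileDeriv Γ μ δ s) s :=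
    fun s hs => hasDerivAt_profile hs
  have hg' : ContinuousOn (profileDeriv Γ μ δ) (Set.Ioi 0) := continuousOn_profileDeriv
  have hωl : ∀ l, Continuous fun y => ω y l := fun l => by fun_prop
  have hωs : ∀ l, HasCompactSupport fun y => ω y l := fun l =>
    hωsupp.comp_left (g := fun v : E3 => v l) rfl
  set K : Fin 3 → E3 → ℝ := fun k => radialKernel (profile Γ μ δ) (EuclideanSpace.proj k) 0
  set K' : Fin 3 → E3 → E3 →L[ℝ] ℝ := fun k =>
    radialKernelFDeriv (profile Γ μ δ) (profileDeriv Γ μ δ) (EuclideanSpace.proj k) 0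
  have hK : ∀ x k l, Integrable fun y => ω y l • K k (x - y) := fun x k l =>
    integrable_smul_comp_sub (hωl l) (hωs l) (locallyIntegrable_radialKernel hp0 hp hg hb) x
  have hK' : ∀ x k l, Integrable fun y => ω y l • K' k (x - y) := fun x k l =>
    integrable_smul_comp_sub (hωl l) (hωs l)
      (locallyIntegrable_radialKernelFDeriv hp0 hp hg hg' hb) x
  have hder : ∀ x k l, HasFDerivAt (fun x => ∫ y, ω y l • K k (x - y))
      (∫ y, ω y l • K' k (x - y)) x := fun x k l =>
    hasFDerivAt_integral_radialKernel (hωl l) (hωs l) hp0 hp hg hg' hb x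
  have hcross : ∀ x y j, cross3 (gradPhi Γ μ δ (x - y)) (ω y) j =
      ∑ k, ∑ l, levi j k l * (ω y l • K k (x - y)) := fun x y j => by
    simp only [cross3_apply, gradPhi_apply, smul_eq_mul, K]
    exact Finset.sum_congr rfl fun k _ => Finset.sum_congr rfl fun l _ => by ring
  have hhess : ∀ x y i j, ∑ k, ∑ l, levi j k l * hessPhi Γ μ δ (x - y) i k * ω y l =
      ∑ k, ∑ l, levi j k l * (ω y l • K' k (x - y)) (e3 i) := fun x y i j => by
    simp only [hessPhi_apply_s8, smul_apply, smul_eq_mul, K']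
    exact Finset.sum_congr rfl fun k _ => Finset.sum_congr rfl fun l _ => by ring
  have hu : ∀ x j, biotSavart Γ μ δ ω x j =
      -(1 / (4 * π)) * ∑ k, ∑ l, levi j k l * ∫ y, ω y l • K k (x - y) := fun x j => by
    have hint : ∀ j, Integrable fun y => cross3 (gradPhi Γ μ δ (x - y)) (ω y) j := fun j => by
      simp only [hcross]
      exact integrable_finsetSum _ fun k _ => integrable_finsetSum _ fun l _ =>
        (hK x k l).const_mul _
    rw [biotSavart, PiLp.smul_apply, smul_eq_mul, eval_integral_piLp hint]
    simp only [hcross]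
    rw [integral_finsetSum _ fun k _ => integrable_finsetSum _ fun l _ => (hK x k l).const_mul _]
    congr 1
    refine Finset.sum_congr rfl fun k _ => ?_
    rw [integral_finsetSum _ fun l _ => (hK x k l).const_mul _]
    exact Finset.sum_congr rfl fun l _ => integral_const_mul _ _
  have hmain : ∀ x j, HasFDerivAt (fun x => biotSavart Γ μ δ ω x j)
      (-(1 / (4 * π)) • ∑ k, ∑ l, levi j k l • ∫ y, ω y l • K' k (x - y)) x := fun x j => by
    simp only [hu]
    exact (HasFDerivAt.fun_sum fun k _ => HasFDerivAt.fun_sum fun l _ =>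
      (hder x k l).const_mul _).const_mul _
  refine ⟨fun x => differentiableAt_euclidean.2 fun j => (hmain x j).differentiableAt,
    fun x i j => ?_⟩
  have happ : ∀ k l, Integrable fun y => levi j k l * (ω y l • K' k (x - y)) (e3 i) :=
    fun k l => ((hK' x k l).apply_continuousLinearMap (e3 i)).const_mul _
  simp only [hhess]
  refine ⟨integrable_finsetSum _ fun k _ => integrable_finsetSum _ fun l _ => happ k l, ?_⟩
  rw [(hmain x j).fderiv,
    integral_finsetSum _ fun k _ => integrable_finsetSum _ fun l _ => happ k l]
  rw [smul_apply, smul_eq_mul, sum_apply]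
  congr 1
  refine Finset.sum_congr rfl fun k _ => ?_
  rw [sum_apply, integral_finsetSum _ fun l _ => happ k l]
  refine Finset.sum_congr rfl fun l _ => ?_
  rw [integral_const_mul, smul_apply, smul_eq_mul, ContinuousLinearMap.integral_apply (hK' x k l)]
end
end

section
/- Let a, b, c ∈ ℝ³. Then the Frobenius contraction Σ_{i,j} [ ((a × c) ⊗ a) + (a ⊗ (a × c)) ]_{ij} (b ⊗ b)_{ij} equals 2 (a · b) ((a × c) · b). Moreover, if a, b, c are unit vectors, its absolute value is at most 2 ‖b × c‖. -/
open MeasureTheory Real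
open scoped RealInnerProductSpace

noncomputable section

theorem inner_cross3_swap (a b c : E3) : ⟪cross3 a c, b⟫ = -⟪a, cross3 b c⟫ := by
  simp [cross3, PiLp.inner_apply, Fin.sum_univ_three]
  ring

theorem frobenius_cross3_contraction (a b c : E3) :
    (∑ i : Fin 3, ∑ j : Fin 3,
        (cross3 a c i * a j + a i * cross3 a c j) * (b i * b j)) =
      2 * ⟪a, b⟫ * ⟪cross3 a c, b⟫ := by
  generalize cross3 a c = v
  simp [PiLp.inner_apply, Fin.sum_univ_three]
  ring

theorem stmt12 (a b c : E3) :
    (∑ i : Fin 3, ∑ j : Fin 3,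
        (cross3 a c i * a j + a i * cross3 a c j) * (b i * b j)) =
      2 * ⟪a, b⟫ * ⟪cross3 a c, b⟫ ∧
    (‖a‖ = 1 → ‖b‖ = 1 → ‖c‖ = 1 →
      |∑ i : Fin 3, ∑ j : Fin 3,
          (cross3 a c i * a j + a i * cross3 a c j) * (b i * b j)| ≤
        2 * ‖cross3 b c‖) := by
  refine ⟨frobenius_cross3_contraction a b c, fun ha hb _ => ?_⟩
  have hab : |⟪a, b⟫| ≤ 1 := by
    simpa [ha, hb] using abs_real_inner_le_norm a b
  have htriple : |⟪a, cross3 b c⟫| ≤ ‖cross3 b c‖ := by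
    simpa [ha] using abs_real_inner_le_norm a (cross3 b c)
  rw [frobenius_cross3_contraction, inner_cross3_swap, abs_mul, abs_mul, abs_neg, abs_two]
  calc 2 * |⟪a, b⟫| * |⟪a, cross3 b c⟫| ≤ 2 * 1 * ‖cross3 b c‖ := by gcongr
    _ = 2 * ‖cross3 b c‖ := by ring
end
end

section
/- Fix Γ > 0, μ > 0 and δ ∈ [0, 4/5]. For every r > 0, the kernel K satisfies K(r) ≤ (1/4) Γ δ(2−δ) μ² ( r^{(10−2δ)/3} + μ² r^{(4+δ)/3} )^{−3/2} + 3Γ ( r^{6/5} + μ² r^{δ−4/5} )^{−5/2} + (3/4) Γ δ² μ⁴ ( r^{(14−4δ)/5} + μ² r^{(4+δ)/5} )^{−5/2}. -/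
open Real

noncomputable section

/-- The kernel `K(r) = (1/4) Γ δ(2−δ) μ² r^{δ−2} A(r)^{−3/2} + (3/8) Γ r² B(r)² A(r)^{−5/2}`. -/
noncomputable def Kker (Γ μ δ r : ℝ) : ℝ :=
  1 / 4 * Γ * δ * (2 - δ) * μ ^ 2 * r ^ (δ - 2) * Afun μ δ r ^ (-(3 : ℝ) / 2) +
  3 / 8 * Γ * r ^ 2 * Bfun μ δ r ^ 2 * Afun μ δ r ^ (-(5 : ℝ) / 2)

/-- Multiplying by a power of `r` can be absorbed into a power of `A(r)`. -/
lemma rpow_mul_Afun_rpow {μ δ r : ℝ} (hr : 0 < r) {a b t p s : ℝ} (ha : a = 2 + s)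
    (hb : b = δ + s) (ht : t = s * p) :
    (r ^ a + μ ^ 2 * r ^ b) ^ p = r ^ t * Afun μ δ r ^ p := by
  have hA : 0 ≤ Afun μ δ r := by unfold Afun; positivity
  have h : r ^ a + μ ^ 2 * r ^ b = r ^ s * Afun μ δ r := by
    rw [ha, hb, rpow_add hr, rpow_add hr, rpow_two, Afun]
    ring
  rw [h, mul_rpow (by positivity) hA, ← rpow_mul hr.le, ht]

/-- The elementary bound `(x + y)² ≤ 2 (x² + y²)` applied to `r B(r)`. -/
lemma sq_mul_Bfun_sq_le {μ δ r : ℝ} (hr : 0 < r) :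
    r ^ 2 * Bfun μ δ r ^ 2 ≤ 8 * r ^ (2 : ℝ) + 2 * δ ^ 2 * μ ^ 4 * r ^ (2 * δ - 2) := by
  have h : r ^ (2 * δ - 2) = r ^ 2 * (r ^ (δ - 2)) ^ 2 := by
    rw [← rpow_two, ← rpow_two, ← rpow_mul hr.le, ← rpow_add hr]
    ring_nf
  rw [h, rpow_two, Bfun]
  nlinarith [mul_nonneg (sq_nonneg r) (sq_nonneg (2 - δ * μ ^ 2 * r ^ (δ - 2)))]

theorem stmt13 (Γ μ δ : ℝ) (hΓ : 0 < Γ) (hμ : 0 < μ) (hδ : δ ∈ Set.Icc (0 : ℝ) (4 / 5)) :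
    ∀ r : ℝ, 0 < r →
      Kker Γ μ δ r ≤
        1 / 4 * Γ * δ * (2 - δ) * μ ^ 2 *
            (r ^ ((10 - 2 * δ) / 3) + μ ^ 2 * r ^ ((4 + δ) / 3)) ^ (-(3 : ℝ) / 2) +
          3 * Γ * (r ^ ((6 : ℝ) / 5) + μ ^ 2 * r ^ (δ - 4 / 5)) ^ (-(5 : ℝ) / 2) +
          3 / 4 * Γ * δ ^ 2 * μ ^ 4 *
            (r ^ ((14 - 4 * δ) / 5) + μ ^ 2 * r ^ ((4 + δ) / 5)) ^ (-(5 : ℝ) / 2) := by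
  intro r hr
  rw [rpow_mul_Afun_rpow (δ := δ) (t := δ - 2) (s := (4 - 2 * δ) / 3) hr (by ring) (by ring)
      (by ring),
    rpow_mul_Afun_rpow (δ := δ) (t := 2) (s := -4 / 5) hr (by ring) (by ring) (by ring),
    rpow_mul_Afun_rpow (δ := δ) (t := 2 * δ - 2) (s := (4 - 4 * δ) / 5) hr (by ring) (by ring)
      (by ring), Kker]
  have hA : 0 ≤ Afun μ δ r := by unfold Afun; positivity
  have h : 0 ≤ 3 / 8 * Γ * Afun μ δ r ^ (-(5 : ℝ) / 2) := by positivity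
  linarith [mul_le_mul_of_nonneg_left (sq_mul_Bfun_sq_le (μ := μ) (δ := δ) hr) h]
end
end

section
/- Fix Γ > 0 and μ > 0, and let δ = 0 (the Rosenhead approximation). Let ω : ℝ³ → ℝ³ be continuous with compact support, define u(x) = −(1/4π) ∫_{ℝ³} ∇φ₀(x − y) × ω(y) dy with φ₀(z) = Γ / √(|z|² + μ²), and let S(x) = (∇u(x) + ∇u(x)ᵀ)/2 be the rate-of-strain tensor. Then for every η > 0, the vorticity stretching term satisfies | ∫_{ℝ³} S(x) : (ω(x) ⊗ ω(x)) dx | ≤ (3Γ/4π) max{ η^{−3}, η² μ^{−5} } ‖ω‖_{L¹(ℝ³)} ‖ω‖²_{L²(ℝ³)}. -/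
open MeasureTheory Real

noncomputable section

/-- The pointwise gradient of the Rosenhead potential `φ₀(z) = Γ / √(|z|² + μ²)`:
`∇φ₀(z) = −Γ (|z|² + μ²)^{−3/2} z`. -/
noncomputable def gradPhiRosenhead (Γ μ : ℝ) (z : E3) : E3 :=
  (-Γ * (‖z‖ ^ 2 + μ ^ 2) ^ (-(3 : ℝ) / 2)) • z

/-- The velocity field given by the approximate Biot–Savart law in the Rosenhead case:
`u(x) = −(1/4π) ∫ ∇φ₀(x − y) × ω(y) dy`. -/
noncomputable def uRosenhead (Γ μ : ℝ) (ω : E3 → E3) (x : E3) : E3 :=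
  (-(1 / (4 * π))) • ∫ y : E3, cross3 (gradPhiRosenhead Γ μ (x - y)) (ω y)

/-- The rate-of-strain tensor `S = (∇u + ∇uᵀ)/2`, `S_{ij} = (∂_i u_j + ∂_j u_i)/2`. -/
noncomputable def strain (u : E3 → E3) (x : E3) (i j : Fin 3) : ℝ :=
  (fderiv ℝ (fun x' : E3 => u x' j) x (e3 i) +
    fderiv ℝ (fun x' : E3 => u x' i) x (e3 j)) / 2

lemma cross3_apply_s17 (a b : E3) (i : Fin 3) :
    cross3 a b i =
      ![a 1 * b 2 - a 2 * b 1, a 2 * b 0 - a 0 * b 2, a 0 * b 1 - a 1 * b 0] i := rfl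

/-- The cross product on `ℝ³` as a continuous bilinear map. -/
def cross3L : E3 →L[ℝ] E3 →L[ℝ] E3 :=
  (LinearMap.mk₂ ℝ cross3
    (fun a a' b => by ext i; fin_cases i <;> simp [cross3_apply_s17] <;> ring)
    (fun c a b => by ext i; fin_cases i <;> simp [cross3_apply_s17] <;> ring)
    (fun a b b' => by ext i; fin_cases i <;> simp [cross3_apply_s17] <;> ring)
    (fun c a b => by ext i; fin_cases i <;> simp [cross3_apply_s17] <;> ring)).toContinuousBilinearMap

lemma cross3L_apply (a b : E3) : cross3L a b = cross3 a b := rfl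

lemma inner_cross3_self (a b : E3) : inner ℝ a (cross3 a b) = 0 := by
  simp [PiLp.inner_apply, Fin.sum_univ_three, cross3_apply_s17]
  ring

lemma norm_cross3_le (a b : E3) : ‖cross3 a b‖ ≤ ‖a‖ * ‖b‖ := by
  refine le_of_sq_le_sq ?_ (by positivity)
  rw [mul_pow]
  simp only [EuclideanSpace.real_norm_sq_eq, Fin.sum_univ_three, cross3_apply_s17]
  simp
  nlinarith [sq_nonneg (a 0 * b 0 + a 1 * b 1 + a 2 * b 2)]

lemma sq_mul_rpow_le_max {r η μ : ℝ} (hr : 0 ≤ r) (hη : 0 < η) (hμ : 0 < μ) :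
    r ^ 2 * (r ^ 2 + μ ^ 2) ^ (-(5 : ℝ) / 2) ≤
      max (η ^ (-(3 : ℝ))) (η ^ 2 * μ ^ (-(5 : ℝ))) := by
  have hsq : ∀ t : ℝ, 0 ≤ t → (t ^ 2) ^ (-(5 : ℝ) / 2) = t ^ (-(5 : ℝ)) := fun t ht => by
    rw [← rpow_natCast, ← rpow_mul ht]
    norm_num
  rcases le_total η r with h | h
  · refine le_max_of_le_left ?_
    have hr0 : 0 < r := hη.trans_le h
    calc r ^ 2 * (r ^ 2 + μ ^ 2) ^ (-(5 : ℝ) / 2)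
        ≤ r ^ 2 * (r ^ 2) ^ (-(5 : ℝ) / 2) := by
          refine mul_le_mul_of_nonneg_left ?_ (by positivity)
          exact rpow_le_rpow_of_nonpos (by positivity) (by nlinarith) (by norm_num)
      _ = r ^ (-(3 : ℝ)) := by
          rw [hsq r hr, ← rpow_natCast, ← rpow_add hr0]
          norm_num
      _ ≤ η ^ (-(3 : ℝ)) := rpow_le_rpow_of_nonpos hη h (by norm_num)
  · refine le_max_of_le_right ?_
    rw [← hsq μ hμ.le]
    refine mul_le_mul (by gcongr) ?_ (by positivity) (by positivity)
    exact rpow_le_rpow_of_nonpos (by positivity) (by nlinarith) (by norm_num)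

/-- The derivative of the gradient of the Rosenhead potential. -/
def hessPhiRosenhead (Γ μ : ℝ) (z : E3) : E3 →L[ℝ] E3 :=
  (-Γ * (‖z‖ ^ 2 + μ ^ 2) ^ (-(3 : ℝ) / 2)) • ContinuousLinearMap.id ℝ E3 +
    ((3 * Γ * (‖z‖ ^ 2 + μ ^ 2) ^ (-(5 : ℝ) / 2)) • innerSL ℝ z).smulRight z

section Rosenhead

variable {Γ μ : ℝ}

lemma hasFDerivAt_gradPhiRosenhead (hμ : 0 < μ) (z : E3) :
    HasFDerivAt (gradPhiRosenhead Γ μ) (hessPhiRosenhead Γ μ z) z := by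
  have hs : ‖z‖ ^ 2 + μ ^ 2 ≠ 0 := by positivity
  have h := ((((hasStrictFDerivAt_norm_sq z).hasFDerivAt.add_const (μ ^ 2)).rpow_const
    (p := -(3 : ℝ) / 2) (Or.inl hs)).const_mul (-Γ)).smul (hasFDerivAt_id z)
  refine h.congr_fderiv ?_
  ext1 v
  have he : (-(3 : ℝ) / 2 - 1) = -(5 : ℝ) / 2 := by norm_num
  simp [hessPhiRosenhead, he, smul_smul]
  module

lemma continuous_gradPhiRosenhead (hμ : 0 < μ) : Continuous (gradPhiRosenhead Γ μ) :=
  continuous_iff_continuousAt.2 fun z => (hasFDerivAt_gradPhiRosenhead hμ z).continuousAt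

lemma continuous_hessPhiRosenhead (hμ : 0 < μ) : Continuous (hessPhiRosenhead Γ μ) := by
  have h : ∀ p : ℝ, Continuous fun z : E3 => (‖z‖ ^ 2 + μ ^ 2) ^ p := fun p =>
    (by fun_prop : Continuous fun z : E3 => ‖z‖ ^ 2 + μ ^ 2).rpow_const
      fun z => Or.inl (by positivity)
  have h3 := h (-(3 : ℝ) / 2)
  have h5 := h (-(5 : ℝ) / 2)
  have hL : Continuous fun z : E3 =>
      (3 * Γ * (‖z‖ ^ 2 + μ ^ 2) ^ (-(5 : ℝ) / 2)) • innerSL ℝ z :=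
    (continuous_const.mul h5).smul (innerSL ℝ).continuous
  have hR : Continuous fun z : E3 =>
      ((3 * Γ * (‖z‖ ^ 2 + μ ^ 2) ^ (-(5 : ℝ) / 2)) • innerSL ℝ z).smulRight z :=
    ((ContinuousLinearMap.smulRightL ℝ E3 E3).continuous.comp hL).clm_apply continuous_id
  exact ((continuous_const.mul h3).smul continuous_const).add hR

lemma norm_hessPhiRosenhead_le (hΓ : 0 < Γ) (hμ : 0 < μ) (z : E3) :
    ‖hessPhiRosenhead Γ μ z‖ ≤ Γ * (μ ^ 2) ^ (-(3 : ℝ) / 2) +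
      3 * Γ * max (μ ^ (-(3 : ℝ))) (μ ^ 2 * μ ^ (-(5 : ℝ))) := by
  refine (norm_add_le _ _).trans (add_le_add ?_ ?_)
  · rw [norm_smul, norm_mul, norm_neg, norm_of_nonneg hΓ.le,
      norm_of_nonneg (by positivity : 0 ≤ (‖z‖ ^ 2 + μ ^ 2) ^ (-(3 : ℝ) / 2))]
    refine (mul_le_of_le_one_right (by positivity) ContinuousLinearMap.norm_id_le).trans ?_
    refine mul_le_mul_of_nonneg_left ?_ hΓ.le
    exact rpow_le_rpow_of_nonpos (by positivity) (by nlinarith [sq_nonneg ‖z‖]) (by norm_num)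
  · rw [ContinuousLinearMap.norm_smulRight_apply, norm_smul, innerSL_apply_norm,
      norm_of_nonneg (by positivity)]
    nlinarith [sq_mul_rpow_le_max (norm_nonneg z) hμ hμ]

lemma inner_cross3_hessPhiRosenhead (z a b : E3) :
    inner ℝ a (cross3 (hessPhiRosenhead Γ μ z a) b) =
      3 * Γ * (‖z‖ ^ 2 + μ ^ 2) ^ (-(5 : ℝ) / 2) * inner ℝ z a * inner ℝ a (cross3 z b) := by
  rw [← cross3L_apply, ← cross3L_apply]
  simp [hessPhiRosenhead, inner_add_right, inner_smul_right, cross3L_apply, inner_cross3_self]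

lemma abs_inner_cross3_hessPhiRosenhead_le (hΓ : 0 < Γ) (hμ : 0 < μ) {η : ℝ} (hη : 0 < η)
    (z a b : E3) :
    |inner ℝ a (cross3 (hessPhiRosenhead Γ μ z a) b)| ≤
      3 * Γ * max (η ^ (-(3 : ℝ))) (η ^ 2 * μ ^ (-(5 : ℝ))) * ‖a‖ ^ 2 * ‖b‖ := by
  rw [inner_cross3_hessPhiRosenhead, abs_mul, abs_mul,
    abs_of_nonneg (by positivity : 0 ≤ 3 * Γ * (‖z‖ ^ 2 + μ ^ 2) ^ (-(5 : ℝ) / 2))]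
  calc _ ≤ 3 * Γ * (‖z‖ ^ 2 + μ ^ 2) ^ (-(5 : ℝ) / 2) * (‖z‖ * ‖a‖) * (‖a‖ * (‖z‖ * ‖b‖)) := by
        gcongr
        · exact abs_real_inner_le_norm z a
        · exact (abs_real_inner_le_norm _ _).trans
            (mul_le_mul_of_nonneg_left (norm_cross3_le z b) (norm_nonneg a))
    _ = 3 * Γ * (‖z‖ ^ 2 * (‖z‖ ^ 2 + μ ^ 2) ^ (-(5 : ℝ) / 2)) * ‖a‖ ^ 2 * ‖b‖ := by ring
    _ ≤ _ := by
        gcongr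
        exact sq_mul_rpow_le_max (norm_nonneg z) hη hμ

variable {ω : E3 → E3}

lemma integrable_hessPhiRosenhead_cross3 (hμ : 0 < μ) (hω : Continuous ω)
    (hωsupp : HasCompactSupport ω) (x : E3) :
    Integrable fun y => (cross3L.flip (ω y)).comp (hessPhiRosenhead Γ μ (x - y)) := by
  refine Continuous.integrable_of_hasCompactSupport ?_ ?_
  · exact (cross3L.flip.continuous.comp hω).clm_comp
      ((continuous_hessPhiRosenhead hμ).comp (continuous_const.sub continuous_id))
  · refine hωsupp.mono fun y hy => ?_
    contrapose! hy
    simp only [Function.mem_support, not_not] at hy ⊢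
    simp [hy]

lemma hasFDerivAt_uRosenhead (hΓ : 0 < Γ) (hμ : 0 < μ) (hω : Continuous ω)
    (hωsupp : HasCompactSupport ω) (x : E3) :
    HasFDerivAt (uRosenhead Γ μ ω) ((-(1 / (4 * π))) •
      ∫ y, (cross3L.flip (ω y)).comp (hessPhiRosenhead Γ μ (x - y))) x := by
  have hcont : ∀ x, Continuous fun y => cross3 (gradPhiRosenhead Γ μ (x - y)) (ω y) := fun x =>
    (cross3L.continuous.comp ((continuous_gradPhiRosenhead hμ).comp
      (continuous_const.sub continuous_id))).clm_apply hω
  have hωint : Integrable fun y => ‖ω y‖ := (hω.integrable_of_hasCompactSupport hωsupp).norm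
  refine HasFDerivAt.const_smul (c := -(1 / (4 * π))) (hasFDerivAt_integral_of_dominated_of_fderiv_le
    (F := fun x y => cross3 (gradPhiRosenhead Γ μ (x - y)) (ω y))
    (F' := fun x y => (cross3L.flip (ω y)).comp (hessPhiRosenhead Γ μ (x - y)))
    (bound := fun y => ‖cross3L.flip‖ * ‖ω y‖ * (Γ * (μ ^ 2) ^ (-(3 : ℝ) / 2) +
      3 * Γ * max (μ ^ (-(3 : ℝ))) (μ ^ 2 * μ ^ (-(5 : ℝ)))))
    Filter.univ_mem ?_ ?_ ?_ ?_ ?_ ?_)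
  · exact .of_forall fun x => (hcont x).aestronglyMeasurable
  · refine (hcont x).integrable_of_hasCompactSupport (hωsupp.mono fun y hy => ?_)
    contrapose! hy
    simp only [Function.mem_support, not_not] at hy ⊢
    rw [hy, ← cross3L_apply, map_zero]
  · exact (integrable_hessPhiRosenhead_cross3 hμ hω hωsupp x).aestronglyMeasurable
  · refine .of_forall fun y x _ => (ContinuousLinearMap.opNorm_comp_le _ _).trans ?_
    exact mul_le_mul (ContinuousLinearMap.le_opNorm _ _) (norm_hessPhiRosenhead_le hΓ hμ _)
      (norm_nonneg _) (by positivity)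
  · exact (hωint.const_mul _).mul_const _
  · refine .of_forall fun y x _ => ?_
    have h := (hasFDerivAt_gradPhiRosenhead (Γ := Γ) hμ (x - y)).comp x
      ((hasFDerivAt_id x).sub_const y)
    exact (cross3L.flip (ω y)).hasFDerivAt.comp x h

lemma sum_strain_mul_eq_inner {u : E3 → E3} {U : E3 →L[ℝ] E3} {x : E3}
    (h : HasFDerivAt u U x) (a : E3) :
    ∑ i : Fin 3, ∑ j : Fin 3, strain u x i j * (a i * a j) = inner ℝ a (U a) := by
  have hd : ∀ i j, fderiv ℝ (fun x' : E3 => u x' j) x (e3 i) = U (e3 i) j := fun i j => by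
    have hj := (EuclideanSpace.proj (𝕜 := ℝ) j).hasFDerivAt.comp x h
    have := hj.fderiv
    exact congrArg (fun L : E3 →L[ℝ] ℝ => L (e3 i)) this
  have ha : a = ∑ i, a i • e3 i := by
    ext k
    fin_cases k <;> simp [e3, Fin.sum_univ_three]
  have hU : ∀ k, U a k = ∑ i, a i * U (e3 i) k := fun k => by
    conv_lhs => rw [ha, map_sum]
    simp [Fin.sum_univ_three]
  simp only [strain, hd, PiLp.inner_apply, hU, Fin.sum_univ_three]
  simp
  ring

lemma abs_sum_strain_uRosenhead_le (hΓ : 0 < Γ) (hμ : 0 < μ) (hω : Continuous ω)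
    (hωsupp : HasCompactSupport ω) {η : ℝ} (hη : 0 < η) (x a : E3) :
    |∑ i : Fin 3, ∑ j : Fin 3, strain (uRosenhead Γ μ ω) x i j * (a i * a j)| ≤
      3 * Γ / (4 * π) * max (η ^ (-(3 : ℝ))) (η ^ 2 * μ ^ (-(5 : ℝ))) *
        (∫ y, ‖ω y‖) * ‖a‖ ^ 2 := by
  have hint := integrable_hessPhiRosenhead_cross3 (Γ := Γ) hμ hω hωsupp x
  have hωint : Integrable fun y => ‖ω y‖ := (hω.integrable_of_hasCompactSupport hωsupp).norm
  rw [sum_strain_mul_eq_inner (hasFDerivAt_uRosenhead hΓ hμ hω hωsupp x),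
    smul_apply, ContinuousLinearMap.integral_apply hint, inner_smul_right,
    ← integral_inner (hint.apply_continuousLinearMap a), abs_mul, abs_neg,
    abs_of_nonneg (by positivity)]
  have hb := norm_integral_le_of_norm_le
    (f := fun y => inner ℝ a (cross3 (hessPhiRosenhead Γ μ (x - y) a) (ω y)))
    (hωint.const_mul (3 * Γ * max (η ^ (-(3 : ℝ))) (η ^ 2 * μ ^ (-(5 : ℝ))) * ‖a‖ ^ 2))
    (.of_forall fun y => abs_inner_cross3_hessPhiRosenhead_le hΓ hμ hη (x - y) a (ω y))
  rw [integral_const_mul] at hb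
  refine (mul_le_mul_of_nonneg_left hb (by positivity)).trans_eq ?_
  ring

end Rosenhead

theorem stmt17 (Γ μ : ℝ) (hΓ : 0 < Γ) (hμ : 0 < μ)
    (ω : E3 → E3) (hω : Continuous ω) (hωsupp : HasCompactSupport ω) :
    ∀ η : ℝ, 0 < η →
      |∫ x : E3, ∑ i : Fin 3, ∑ j : Fin 3,
          strain (uRosenhead Γ μ ω) x i j * (ω x i * ω x j)| ≤
        3 * Γ / (4 * π) * max (η ^ (-(3 : ℝ))) (η ^ 2 * μ ^ (-(5 : ℝ))) *
          (∫ x : E3, ‖ω x‖) * ∫ x : E3, ‖ω x‖ ^ 2 := by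
  intro η hη
  have hsq : Integrable fun x => ‖ω x‖ ^ 2 := by
    refine (hω.norm.pow 2).integrable_of_hasCompactSupport (hωsupp.mono fun y hy => ?_)
    contrapose! hy
    simp only [Function.mem_support, not_not] at hy ⊢
    simp [hy]
  rw [← integral_const_mul, ← norm_eq_abs]
  refine norm_integral_le_of_norm_le (hsq.const_mul _)
    (.of_forall fun x => ?_)
  exact abs_sum_strain_uRosenhead_le hΓ hμ hω hωsupp hη x (ω x)
end
end
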